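/- Let g be in normal form and let ν₀ = (0, y₀, z₀) ∈ ℝ³ be a unit vector. Then the following are equivalent: (i) h_{ν₀} has a critical point at (0,0) whose Hessian at (0,0) is nonzero but degenerate (not invertible), and h_{ν₀} has neither an A₂ nor an A₃ singularity at (0,0); (ii) one of the following holds: (4a) b₂ y₀ + a_{2,0} z₀ = 0, y₀ ≠ 0, b₃ y₀ + a_{3,0} z₀ = 0 and b₄ y₀² + a_{4,0} y₀ z₀ − 3 a_{2,1}² z₀² = 0; or (4b) y₀ = 0, a_{2,0} ≠ 0, a_{0,3} = 0 and a_{2,0} a_{0,4} − 3 a_{1,2}² = 0. -/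

import Mathlib

open Real Set

noncomputable section

/-- Partial derivative in the first variable. -/
def pdu {F : Type*} [NormedAddCommGroup F] [NormedSpace ℝ F] (f : ℝ → ℝ → F) : ℝ → ℝ → F :=
  fun u w => deriv (fun t => f t w) u

/-- Partial derivative in the second variable. -/
def pdw {F : Type*} [NormedAddCommGroup F] [NormedSpace ℝ F] (f : ℝ → ℝ → F) : ℝ → ℝ → F :=
  fun u w => deriv (fun t => f u t) w

/-- Iterated partial derivative `∂_u^i ∂_w^j f`. -/
def pd {F : Type*} [NormedAddCommGroup F] [NormedSpace ℝ F] (i j : ℕ) (f : ℝ → ℝ → F) :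
    ℝ → ℝ → F :=
  pdu^[i] (pdw^[j] f)

/-- The Euclidean inner product on `ℝ³ = ℝ × ℝ × ℝ`. -/
def dot3 (x y : ℝ × ℝ × ℝ) : ℝ := x.1 * y.1 + x.2.1 * y.2.1 + x.2.2 * y.2.2

/-- The cross product on `ℝ³ = ℝ × ℝ × ℝ`. -/
def cross3 (x y : ℝ × ℝ × ℝ) : ℝ × ℝ × ℝ :=
  (x.2.1 * y.2.2 - x.2.2 * y.2.1, x.2.2 * y.1 - x.1 * y.2.2, x.1 * y.2.1 - x.2.1 * y.1)

/-- The Euclidean norm on `ℝ³ = ℝ × ℝ × ℝ`. -/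
def norm3 (x : ℝ × ℝ × ℝ) : ℝ := Real.sqrt (dot3 x x)

/-- The surface parameterization `g(u,w) = (u, p(u,w), q(u,w))`. -/
def gmap (p q : ℝ → ℝ → ℝ) : ℝ → ℝ → ℝ × ℝ × ℝ := fun u w => (u, p u w, q u w)

/-- The height function on the surface parameterized by `g = (u, p, q)` along `v`. -/
def hgt (p q : ℝ → ℝ → ℝ) (v : ℝ × ℝ × ℝ) : ℝ → ℝ → ℝ :=
  fun u w => dot3 (gmap p q u w) v

/-- `g = (u, p(u,w), q(u,w))` is in normal form of order `N`. -/
def NormalFormN (N : ℕ) (p q : ℝ → ℝ → ℝ) (b : ℕ → ℝ) (a : ℕ → ℕ → ℝ) : Prop :=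
  ContDiff ℝ (⊤ : ℕ∞) (fun x : ℝ × ℝ => p x.1 x.2) ∧
  ContDiff ℝ (⊤ : ℕ∞) (fun x : ℝ × ℝ => q x.1 x.2) ∧
  p 0 0 = 0 ∧ q 0 0 = 0 ∧
  pd 1 0 p 0 0 = 0 ∧ pd 0 1 p 0 0 = 0 ∧ pd 1 0 q 0 0 = 0 ∧ pd 0 1 q 0 0 = 0 ∧
  pd 0 2 p 0 0 = 1 ∧
  (∀ i, 2 ≤ i → i ≤ N → pd i 0 p 0 0 = b i) ∧
  (∀ i j, 2 ≤ i + j → i + j ≤ N → 1 ≤ j → ¬(i = 0 ∧ j = 2) → pd i j p 0 0 = 0) ∧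
  (∀ i j, 2 ≤ i + j → i + j ≤ N → pd i j q 0 0 = a i j) ∧
  a 1 1 = 0 ∧ a 0 2 = 0

/-- `h` has an `A_k` singularity at the origin: up to a `C^∞` change of coordinates fixing
the origin, `h` equals `h(0,0) ± x² ± y^(k+1)`. -/
def HasAkSingAt (h : ℝ → ℝ → ℝ) (k : ℕ) : Prop :=
  ∃ (U V : Set (ℝ × ℝ)) (φ ψ : ℝ × ℝ → ℝ × ℝ) (ε₁ ε₂ : ℝ),
    IsOpen U ∧ IsOpen V ∧ ((0, 0) : ℝ × ℝ) ∈ U ∧ ((0, 0) : ℝ × ℝ) ∈ V ∧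
    ContDiffOn ℝ (⊤ : ℕ∞) φ U ∧ ContDiffOn ℝ (⊤ : ℕ∞) ψ V ∧
    Set.MapsTo φ U V ∧ Set.MapsTo ψ V U ∧
    (∀ x ∈ U, ψ (φ x) = x) ∧ (∀ y ∈ V, φ (ψ y) = y) ∧
    φ (0, 0) = (0, 0) ∧ (ε₁ = 1 ∨ ε₁ = -1) ∧ (ε₂ = 1 ∨ ε₂ = -1) ∧
    ∀ x ∈ U, h (φ x).1 (φ x).2 = h 0 0 + ε₁ * x.1 ^ 2 + ε₂ * x.2 ^ (k + 1)

/-- The parabolic-set function `Σ = ⟨g_uu, g_u × g_w⟩⟨g_ww, g_u × g_w⟩ − ⟨g_uw, g_u × g_w⟩²`. -/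
def SigmaFun (p q : ℝ → ℝ → ℝ) : ℝ → ℝ → ℝ := fun u w =>
  dot3 (pd 2 0 (gmap p q) u w) (cross3 (pd 1 0 (gmap p q) u w) (pd 0 1 (gmap p q) u w)) *
      dot3 (pd 0 2 (gmap p q) u w) (cross3 (pd 1 0 (gmap p q) u w) (pd 0 1 (gmap p q) u w)) -
    dot3 (pd 1 1 (gmap p q) u w) (cross3 (pd 1 0 (gmap p q) u w) (pd 0 1 (gmap p q) u w)) ^ 2

/-- The torsion of a space curve `L`. -/
def tor (L : ℝ → ℝ × ℝ × ℝ) : ℝ → ℝ := fun t =>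
  dot3 (cross3 (deriv L t) (deriv (deriv L) t)) (deriv (deriv (deriv L)) t) /
    norm3 (cross3 (deriv L t) (deriv (deriv L) t)) ^ 2

/-- The unit binormal vector of a space curve `L` at `t = 0`. -/
def binormal0 (L : ℝ → ℝ × ℝ × ℝ) : ℝ × ℝ × ℝ :=
  (norm3 (cross3 (deriv L 0) (deriv (deriv L) 0)))⁻¹ • cross3 (deriv L 0) (deriv (deriv L) 0)

/-- `f` is a parabolic Monge form with `∂_w² f(0,0) = k₂ ≠ 0`. -/
def MongeForm (f : ℝ → ℝ → ℝ) (k₂ : ℝ) : Prop :=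
  ContDiff ℝ (⊤ : ℕ∞) (fun x : ℝ × ℝ => f x.1 x.2) ∧ f 0 0 = 0 ∧
  pd 1 0 f 0 0 = 0 ∧ pd 0 1 f 0 0 = 0 ∧
  pd 2 0 f 0 0 = 0 ∧ pd 1 1 f 0 0 = 0 ∧ pd 0 2 f 0 0 = k₂ ∧ k₂ ≠ 0

/-- The parabolic-set function `P = f_uu f_ww − f_uw²` of a Monge form. -/
def Pfun (f : ℝ → ℝ → ℝ) : ℝ → ℝ → ℝ := fun u w =>
  pd 2 0 f u w * pd 0 2 f u w - pd 1 1 f u w ^ 2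

open Filter Topology ContDiff

theorem contDiff_nat_integral_zero_one (n : ℕ) :
    ∀ {F : Type} [NormedAddCommGroup F] [NormedSpace ℝ F]
      {f : (ℝ × ℝ) → ℝ → F}, ContDiff ℝ n (fun x : (ℝ × ℝ) × ℝ => f x.1 x.2) →
      ContDiff ℝ n (fun x => ∫ t in (0 : ℝ)..1, f x t) := by
  induction n with
  | zero =>
    intro F _ _ f hf
    have hc : Continuous (fun x : (ℝ × ℝ) × ℝ => f x.1 x.2) := hf.continuous
    have : Continuous (fun x => ∫ t in (0 : ℝ)..1, f x t) :=
      intervalIntegral.continuous_parametric_intervalIntegral_of_continuous' hc 0 1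
    exact contDiff_zero.2 this
  | succ n ih =>
    intro F _ _ f hf
    set f' : (ℝ × ℝ) → ℝ → ((ℝ × ℝ) →L[ℝ] F) := fun x t =>
      (fderiv ℝ (fun x : (ℝ × ℝ) × ℝ => f x.1 x.2) (x, t)).comp
        (ContinuousLinearMap.inl ℝ (ℝ × ℝ) ℝ) with hf'
    have hsm : ContDiff ℝ n (fun x : (ℝ × ℝ) × ℝ => f' x.1 x.2) := by
      have h1 : ContDiff ℝ n (fderiv ℝ (fun x : (ℝ × ℝ) × ℝ => f x.1 x.2)) :=
        hf.fderiv_right (by norm_cast)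
      exact h1.clm_comp contDiff_const
    have hdiff : Differentiable ℝ (fun x : (ℝ × ℝ) × ℝ => f x.1 x.2) :=
      hf.differentiable (by norm_cast)
    have hder : ∀ x t, HasFDerivAt (fun y => f y t) (f' x t) x := by
      intro x t
      have h2 : HasFDerivAt (fun y : ℝ × ℝ => (y, t)) (ContinuousLinearMap.inl ℝ (ℝ × ℝ) ℝ) x :=
        hasFDerivAt_prodMk_left x t
      exact (hdiff (x, t)).hasFDerivAt.comp x h2
    have hcf : Continuous (fun x : (ℝ × ℝ) × ℝ => f x.1 x.2) := hf.continuous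
    have hcf' : Continuous (fun x : (ℝ × ℝ) × ℝ => f' x.1 x.2) := hsm.continuous
    have key : ∀ x, HasFDerivAt (fun x => ∫ t in (0 : ℝ)..1, f x t)
        (∫ t in (0 : ℝ)..1, f' x t) x := by
      intro x
      obtain ⟨C, hC⟩ := ((isCompact_closedBall x (1 : ℝ)).prod
        (isCompact_Icc (a := (0 : ℝ)) (b := 1))).exists_bound_of_continuousOn hcf'.continuousOn
      refine (intervalIntegral.hasFDerivAt_integral_of_dominated_of_fderiv_le
        (bound := fun _ => C) (Metric.closedBall_mem_nhds x one_pos) ?_ ?_ ?_ ?_ ?_ ?_)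
      · exact Eventually.of_forall fun y =>
          (hcf.comp (Continuous.prodMk_right y)).aestronglyMeasurable
      · exact (hcf.comp (Continuous.prodMk_right x)).intervalIntegrable _ _
      · exact (hcf'.comp (Continuous.prodMk_right x)).aestronglyMeasurable
      · refine Eventually.of_forall fun t ht y hy => hC (y, t) ⟨hy, ?_⟩
        rw [uIoc_of_le zero_le_one] at ht
        exact ⟨ht.1.le, ht.2⟩
      · exact intervalIntegrable_const
      · exact Eventually.of_forall fun t _ y _ => hder y t
    have := ih hsm
    push_cast
    exact contDiff_succ_iff_hasFDerivAt.2 ⟨_, this, key⟩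

theorem exists_smooth_quotient_snd {f : ℝ × ℝ → ℝ} (hf : ContDiff ℝ ∞ f) :
    ∃ g : ℝ × ℝ → ℝ, ContDiff ℝ ∞ g ∧ ∀ x, f x = f (x.1, 0) + x.2 * g x := by
  have hd : ContDiff ℝ ∞ (fun x : ℝ × ℝ => fderiv ℝ f x (0, 1)) :=
    (hf.fderiv_right le_rfl).clm_apply contDiff_const
  refine ⟨fun x => ∫ t in (0 : ℝ)..1, fderiv ℝ f (x.1, t * x.2) (0, 1), ?_, ?_⟩
  · refine contDiff_infty.2 fun n => contDiff_nat_integral_zero_one n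
      (f := fun x t => fderiv ℝ f (x.1, t * x.2) (0, 1)) ?_
    exact (hd.comp (g := fun x : ℝ × ℝ => fderiv ℝ f x (0, 1))
      (f := fun y : (ℝ × ℝ) × ℝ => (y.1.1, y.2 * y.1.2)) (by fun_prop)).of_le (by exact_mod_cast le_top)
  · intro x
    have hder : ∀ t : ℝ, HasDerivAt (fun t : ℝ => f (x.1, t * x.2))
        (x.2 * fderiv ℝ f (x.1, t * x.2) (0, 1)) t := by
      intro t
      have h1 : HasDerivAt (fun t : ℝ => ((x.1, t * x.2) : ℝ × ℝ)) (0, x.2) t := by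
        simpa using (hasDerivAt_const t x.1).prodMk ((hasDerivAt_id t).mul_const x.2)
      have h2 := ((hf.differentiable (by simp)) (x.1, t * x.2)).hasFDerivAt.comp_hasDerivAt t h1
      have h3 : ((0, x.2) : ℝ × ℝ) = x.2 • ((0, 1) : ℝ × ℝ) := by simp
      rw [h3, map_smul, smul_eq_mul] at h2
      exact h2
    have hc : Continuous fun t : ℝ => x.2 * fderiv ℝ f (x.1, t * x.2) (0, 1) :=
      continuous_const.mul (hd.continuous.comp (by fun_prop : Continuous fun t : ℝ => (x.1, t * x.2)))
    have := intervalIntegral.integral_eq_sub_of_hasDerivAt (fun t _ => hder t)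
      (hc.intervalIntegrable 0 1)
    rw [intervalIntegral.integral_const_mul] at this
    simp only [this, one_mul, zero_mul]
    ring

theorem exists_smooth_quotient {f : ℝ → ℝ} (hf : ContDiff ℝ ∞ f) :
    ∃ g : ℝ → ℝ, ContDiff ℝ ∞ g ∧ ∀ u, f u = f 0 + u * g u := by
  obtain ⟨g, hg, h⟩ := exists_smooth_quotient_snd (hf.comp (contDiff_snd (E := ℝ)))
  exact ⟨fun u => g (0, u), hg.comp (by fun_prop), fun u => h (0, u)⟩

theorem iteratedDeriv_const_add_id_mul {f g : ℝ → ℝ} {c : ℝ} (hg : ContDiff ℝ ∞ g)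
    (h : ∀ u, f u = c + u * g u) (n : ℕ) (u : ℝ) :
    iteratedDeriv (n + 1) f u = (n + 1) * iteratedDeriv n g u + u * iteratedDeriv (n + 1) g u := by
  have hd : ∀ k u, HasDerivAt (iteratedDeriv k g) (iteratedDeriv (k + 1) g u) u := by
    intro k u
    rw [iteratedDeriv_succ]
    exact ((hg.differentiable_iteratedDeriv k (by exact_mod_cast ENat.natCast_lt_top k)) u).hasDerivAt
  induction n generalizing u with
  | zero =>
    have h1 : HasDerivAt f (g u + u * iteratedDeriv 1 g u) u := by
      rw [funext h]
      simpa using ((hasDerivAt_id u).mul (hd 0 u)).const_add c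
    simpa using h1.deriv
  | succ n ih =>
    rw [iteratedDeriv_succ, funext ih]
    have h1 := ((hd n u).const_mul ((n : ℝ) + 1)).add ((hasDerivAt_id u).mul (hd (n + 1) u))
    refine (h1.congr_deriv ?_).deriv
    push_cast
    simp only [id]
    ring

theorem iteratedDeriv_quotient_zero {f g : ℝ → ℝ} {c : ℝ} (hg : ContDiff ℝ ∞ g)
    (h : ∀ u, f u = c + u * g u) (n : ℕ) :
    iteratedDeriv (n + 1) f 0 = (n + 1) * iteratedDeriv n g 0 := by
  simpa using iteratedDeriv_const_add_id_mul hg h n 0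

theorem pdu_eq_fderiv {f : ℝ → ℝ → ℝ} (hf : ContDiff ℝ ∞ (fun x : ℝ × ℝ => f x.1 x.2)) (u w : ℝ) :
    pdu f u w = fderiv ℝ (fun x : ℝ × ℝ => f x.1 x.2) (u, w) (1, 0) := by
  have h1 : HasDerivAt (fun t : ℝ => ((t, w) : ℝ × ℝ)) (1, 0) u :=
    (hasDerivAt_id u).prodMk (hasDerivAt_const u w)
  exact ((hf.differentiable (by simp) (u, w)).hasFDerivAt.comp_hasDerivAt u h1).deriv

theorem pdw_eq_fderiv {f : ℝ → ℝ → ℝ} (hf : ContDiff ℝ ∞ (fun x : ℝ × ℝ => f x.1 x.2)) (u w : ℝ) :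
    pdw f u w = fderiv ℝ (fun x : ℝ × ℝ => f x.1 x.2) (u, w) (0, 1) := by
  have h1 : HasDerivAt (fun t : ℝ => ((u, t) : ℝ × ℝ)) (0, 1) w :=
    (hasDerivAt_const w u).prodMk (hasDerivAt_id w)
  exact ((hf.differentiable (by simp) (u, w)).hasFDerivAt.comp_hasDerivAt w h1).deriv

theorem contDiff_pdu {f : ℝ → ℝ → ℝ} (hf : ContDiff ℝ ∞ (fun x : ℝ × ℝ => f x.1 x.2)) :
    ContDiff ℝ ∞ (fun x : ℝ × ℝ => pdu f x.1 x.2) := by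
  rw [funext fun x : ℝ × ℝ => pdu_eq_fderiv hf x.1 x.2]
  exact (hf.fderiv_right le_rfl).clm_apply contDiff_const

theorem contDiff_pdw {f : ℝ → ℝ → ℝ} (hf : ContDiff ℝ ∞ (fun x : ℝ × ℝ => f x.1 x.2)) :
    ContDiff ℝ ∞ (fun x : ℝ × ℝ => pdw f x.1 x.2) := by
  rw [funext fun x : ℝ × ℝ => pdw_eq_fderiv hf x.1 x.2]
  exact (hf.fderiv_right le_rfl).clm_apply contDiff_const

theorem contDiff_pdu_iterate {f : ℝ → ℝ → ℝ} (hf : ContDiff ℝ ∞ (fun x : ℝ × ℝ => f x.1 x.2))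
    (i : ℕ) : ContDiff ℝ ∞ (fun x : ℝ × ℝ => (pdu^[i] f) x.1 x.2) := by
  induction i with
  | zero => exact hf
  | succ i ih =>
    rw [Function.iterate_succ_apply']
    exact contDiff_pdu ih

theorem contDiff_pdw_iterate {f : ℝ → ℝ → ℝ} (hf : ContDiff ℝ ∞ (fun x : ℝ × ℝ => f x.1 x.2))
    (j : ℕ) : ContDiff ℝ ∞ (fun x : ℝ × ℝ => (pdw^[j] f) x.1 x.2) := by
  induction j with
  | zero => exact hf
  | succ j ih =>
    rw [Function.iterate_succ_apply']
    exact contDiff_pdw ih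

theorem pdu_linear_combination {f g : ℝ → ℝ → ℝ} (c d : ℝ)
    (hf : ContDiff ℝ ∞ (fun x : ℝ × ℝ => f x.1 x.2))
    (hg : ContDiff ℝ ∞ (fun x : ℝ × ℝ => g x.1 x.2)) :
    pdu (fun u w => c * f u w + d * g u w) = fun u w => c * pdu f u w + d * pdu g u w := by
  funext u w
  have h1 : DifferentiableAt ℝ (fun t => f t w) u :=
    ((hf.comp (f := fun t : ℝ => (t, w)) (by fun_prop)).differentiable (by simp)) u
  have h2 : DifferentiableAt ℝ (fun t => g t w) u :=
    ((hg.comp (f := fun t : ℝ => (t, w)) (by fun_prop)).differentiable (by simp)) u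
  exact ((h1.hasDerivAt.const_mul c).add (h2.hasDerivAt.const_mul d)).deriv

theorem pdw_linear_combination {f g : ℝ → ℝ → ℝ} (c d : ℝ)
    (hf : ContDiff ℝ ∞ (fun x : ℝ × ℝ => f x.1 x.2))
    (hg : ContDiff ℝ ∞ (fun x : ℝ × ℝ => g x.1 x.2)) :
    pdw (fun u w => c * f u w + d * g u w) = fun u w => c * pdw f u w + d * pdw g u w := by
  funext u w
  have h1 : DifferentiableAt ℝ (fun t => f u t) w :=
    ((hf.comp (f := fun t : ℝ => (u, t)) (by fun_prop)).differentiable (by simp)) w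
  have h2 : DifferentiableAt ℝ (fun t => g u t) w :=
    ((hg.comp (f := fun t : ℝ => (u, t)) (by fun_prop)).differentiable (by simp)) w
  exact ((h1.hasDerivAt.const_mul c).add (h2.hasDerivAt.const_mul d)).deriv

theorem pd_linear_combination {f g : ℝ → ℝ → ℝ} (c d : ℝ)
    (hf : ContDiff ℝ ∞ (fun x : ℝ × ℝ => f x.1 x.2))
    (hg : ContDiff ℝ ∞ (fun x : ℝ × ℝ => g x.1 x.2)) (i j : ℕ) :
    pd i j (fun u w => c * f u w + d * g u w) = fun u w => c * pd i j f u w + d * pd i j g u w := by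
  have hw : pdw^[j] (fun u w => c * f u w + d * g u w) =
      fun u w => c * (pdw^[j] f) u w + d * (pdw^[j] g) u w := by
    induction j with
    | zero => rfl
    | succ j ih =>
      simp only [Function.iterate_succ_apply', ih]
      exact pdw_linear_combination c d (contDiff_pdw_iterate hf j) (contDiff_pdw_iterate hg j)
  unfold pd
  rw [hw]
  induction i with
  | zero => rfl
  | succ i ih =>
    simp only [Function.iterate_succ_apply', ih]
    exact pdu_linear_combination c d (contDiff_pdu_iterate (contDiff_pdw_iterate hf j) i)
      (contDiff_pdu_iterate (contDiff_pdw_iterate hg j) i)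

theorem pdu_pdw_comm {f : ℝ → ℝ → ℝ} (hf : ContDiff ℝ ∞ (fun x : ℝ × ℝ => f x.1 x.2)) :
    pdu (pdw f) = pdw (pdu f) := by
  funext u w
  have hd : Differentiable ℝ (fderiv ℝ (fun x : ℝ × ℝ => f x.1 x.2)) :=
    (hf.fderiv_right (m := ∞) le_rfl).differentiable (by simp)
  have hsymm : IsSymmSndFDerivAt ℝ (fun x : ℝ × ℝ => f x.1 x.2) (u, w) :=
    hf.contDiffAt.isSymmSndFDerivAt (by
      rw [minSmoothness_of_isRCLikeNormedField]; exact WithTop.coe_le_coe.2 le_top)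
  have happ : ∀ v v' : ℝ × ℝ, fderiv ℝ (fun x => fderiv ℝ (fun x : ℝ × ℝ => f x.1 x.2) x v)
      (u, w) v' = fderiv ℝ (fderiv ℝ (fun x : ℝ × ℝ => f x.1 x.2)) (u, w) v' v := by
    intro v v'
    rw [fderiv_clm_apply (hd _) (differentiableAt_const v)]
    simp
  rw [pdu_eq_fderiv (contDiff_pdw hf), pdw_eq_fderiv (contDiff_pdu hf),
    funext fun x : ℝ × ℝ => pdu_eq_fderiv hf x.1 x.2,
    funext fun x : ℝ × ℝ => pdw_eq_fderiv hf x.1 x.2, happ, happ]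
  exact hsymm _ _

theorem pdw_pdu_iterate_comm {f : ℝ → ℝ → ℝ} (hf : ContDiff ℝ ∞ (fun x : ℝ × ℝ => f x.1 x.2))
    (i : ℕ) : pdw (pdu^[i] f) = pdu^[i] (pdw f) := by
  induction i with
  | zero => rfl
  | succ i ih =>
    rw [Function.iterate_succ_apply', Function.iterate_succ_apply',
      ← pdu_pdw_comm (contDiff_pdu_iterate hf i), ih]

theorem pd_eq_pdw_iterate_pdu_iterate {f : ℝ → ℝ → ℝ}
    (hf : ContDiff ℝ ∞ (fun x : ℝ × ℝ => f x.1 x.2)) (i j : ℕ) :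
    pd i j f = pdw^[j] (pdu^[i] f) := by
  unfold pd
  induction j with
  | zero => rfl
  | succ j ih =>
    rw [Function.iterate_succ_apply', Function.iterate_succ_apply', ← ih,
      pdw_pdu_iterate_comm (contDiff_pdw_iterate hf j)]

theorem pd_swap {f : ℝ → ℝ → ℝ} (hf : ContDiff ℝ ∞ (fun x : ℝ × ℝ => f x.1 x.2)) (i j : ℕ)
    (u w : ℝ) : pd i j (fun u w => f w u) u w = pd j i f w u := by
  have h1 : ∀ j, pdw^[j] (fun u w => f w u) = fun u w => (pdu^[j] f) w u := by
    intro j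
    induction j with
    | zero => rfl
    | succ j ih => simp only [Function.iterate_succ_apply', ih]; rfl
  have h2 : ∀ (g : ℝ → ℝ → ℝ) i, pdu^[i] (fun u w => g w u) = fun u w => (pdw^[i] g) w u := by
    intro g i
    induction i with
    | zero => rfl
    | succ i ih => simp only [Function.iterate_succ_apply', ih]; rfl
  rw [pd_eq_pdw_iterate_pdu_iterate hf, pd, h1, h2]

theorem pdu_iterate_eq_iteratedDeriv (f : ℝ → ℝ → ℝ) (i : ℕ) (u w : ℝ) :
    (pdu^[i] f) u w = iteratedDeriv i (fun t => f t w) u := by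
  induction i generalizing u with
  | zero => simp
  | succ i ih =>
    rw [Function.iterate_succ_apply', iteratedDeriv_succ, ← funext ih]
    rfl

/-- A smooth function with a critical point whose Hessian is `diag(0, c)` at the origin splits as
a cubic remainder in `u`, a term linear in `w` and a multiple of `w²`, with smooth coefficients. -/
theorem exists_cubic_decomposition {h : ℝ → ℝ → ℝ}
    (hh : ContDiff ℝ ∞ (fun x : ℝ × ℝ => h x.1 x.2))
    (h10 : pd 1 0 h 0 0 = 0) (h01 : pd 0 1 h 0 0 = 0) (h20 : pd 2 0 h 0 0 = 0)
    (h11 : pd 1 1 h 0 0 = 0) :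
    ∃ (α α' β : ℝ → ℝ) (γ : ℝ × ℝ → ℝ), ContDiff ℝ ∞ α ∧ ContDiff ℝ ∞ α' ∧ ContDiff ℝ ∞ β ∧
      ContDiff ℝ ∞ γ ∧
      (∀ u w, h u w = h 0 0 + u ^ 3 * α u + u ^ 2 * β u * w + γ (u, w) * w ^ 2) ∧
      (∀ u, α u = α 0 + u * α' u) ∧ pd 3 0 h 0 0 = 6 * α 0 ∧ pd 4 0 h 0 0 = 24 * α' 0 ∧
      pd 2 1 h 0 0 = 2 * β 0 ∧ pd 0 2 h 0 0 = 2 * γ (0, 0) := by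
  obtain ⟨h₁, hh₁, e₁⟩ := exists_smooth_quotient_snd hh
  obtain ⟨γ, hγ, e₂⟩ := exists_smooth_quotient_snd hh₁
  have hα₀ : ContDiff ℝ ∞ (fun u => h u 0) := hh.comp (f := fun u : ℝ => (u, (0 : ℝ))) (by fun_prop)
  have hβ₀ : ContDiff ℝ ∞ (fun u => h₁ (u, 0)) := hh₁.comp (by fun_prop)
  have hγ₀ : ∀ u, ContDiff ℝ ∞ (fun w => γ (u, w)) := fun u => hγ.comp (by fun_prop)
  have hh₁' : ∀ u, ContDiff ℝ ∞ (fun w => h₁ (u, w)) := fun u => hh₁.comp (by fun_prop)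
  have pw : ∀ u, pdw h u 0 = h₁ (u, 0) := fun u => by
    simpa [pdw] using iteratedDeriv_quotient_zero (f := fun w => h u w) (c := h u 0) (hh₁' u)
      (fun w => e₁ (u, w)) 0
  have pi0 : ∀ i, pd i 0 h 0 0 = iteratedDeriv i (fun u => h u 0) 0 := fun i =>
    pdu_iterate_eq_iteratedDeriv h i 0 0
  have pi1 : ∀ i, pd i 1 h 0 0 = iteratedDeriv i (fun u => h₁ (u, 0)) 0 := fun i => by
    rw [← funext pw]
    exact pdu_iterate_eq_iteratedDeriv (pdw h) i 0 0
  have p02 : pd 0 2 h 0 0 = 2 * γ (0, 0) := by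
    have a1 : pd 0 2 h 0 0 = iteratedDeriv 2 (fun w => h 0 w) 0 := by
      simp [pd, pdw, iteratedDeriv_succ]
    have a2 := iteratedDeriv_quotient_zero (f := fun w => h 0 w) (c := h 0 0) (hh₁' 0)
      (fun w => e₁ (0, w)) 1
    have a3 := iteratedDeriv_quotient_zero (f := fun w => h₁ (0, w)) (c := h₁ (0, 0)) (hγ₀ 0)
      (fun w => e₂ (0, w)) 0
    rw [a1, a2, a3]
    norm_num
  obtain ⟨α₁, hα₁, d₁⟩ := exists_smooth_quotient hα₀
  obtain ⟨α₂, hα₂, d₂⟩ := exists_smooth_quotient hα₁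
  obtain ⟨α₃, hα₃, d₃⟩ := exists_smooth_quotient hα₂
  obtain ⟨α₄, hα₄, d₄⟩ := exists_smooth_quotient hα₃
  obtain ⟨β₁, hβ₁, f₁⟩ := exists_smooth_quotient hβ₀
  obtain ⟨β₂, hβ₂, f₂⟩ := exists_smooth_quotient hβ₁
  have r₁ := iteratedDeriv_quotient_zero hα₁ d₁
  have r₂ := iteratedDeriv_quotient_zero hα₂ d₂
  have r₃ := iteratedDeriv_quotient_zero hα₃ d₃
  have r₄ := iteratedDeriv_quotient_zero hα₄ d₄
  have s₁ := iteratedDeriv_quotient_zero hβ₁ f₁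
  have s₂ := iteratedDeriv_quotient_zero hβ₂ f₂
  have p10 : pd 1 0 h 0 0 = α₁ 0 := by rw [pi0, r₁ 0]; simp
  have p20 : pd 2 0 h 0 0 = 2 * α₂ 0 := by rw [pi0, r₁ 1, r₂ 0]; norm_num
  have p30 : pd 3 0 h 0 0 = 6 * α₃ 0 := by rw [pi0, r₁ 2, r₂ 1, r₃ 0]; norm_num; ring
  have p40 : pd 4 0 h 0 0 = 24 * α₄ 0 := by rw [pi0, r₁ 3, r₂ 2, r₃ 1, r₄ 0]; norm_num; ring
  have p01 : pd 0 1 h 0 0 = h₁ (0, 0) := by rw [pi1]; simp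
  have p11 : pd 1 1 h 0 0 = β₁ 0 := by rw [pi1, s₁ 0]; simp
  have p21 : pd 2 1 h 0 0 = 2 * β₂ 0 := by rw [pi1, s₁ 1, s₂ 0]; norm_num
  refine ⟨α₃, α₄, β₂, γ, hα₃, hα₄, hβ₂, hγ, fun u w => ?_, d₄, p30, p40, p21, p02⟩
  have z₁ : α₁ 0 = 0 := by rw [← p10, h10]
  have z₂ : α₂ 0 = 0 := by linarith
  have z₃ : h₁ (0, 0) = 0 := by rw [← p01, h01]
  have z₄ : β₁ 0 = 0 := by rw [← p11, h11]
  have g₁ := e₁ (u, w)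
  have g₂ := e₂ (u, w)
  have g₃ := d₁ u
  have g₄ := f₁ u
  simp only at g₁ g₂ g₃ g₄
  rw [g₁, g₂, g₃, g₄, d₂ u, d₃ u, f₂ u, z₁, z₂, z₃, z₄]
  ring

/-- The `C^∞` inverse function theorem at the origin of the plane, on open neighbourhoods. -/
theorem exists_smooth_local_inverse {Φ : ℝ × ℝ → ℝ × ℝ} {e : (ℝ × ℝ) ≃L[ℝ] (ℝ × ℝ)}
    (hΦ : ∀ᶠ x in 𝓝 (0 : ℝ × ℝ), ContDiffAt ℝ ∞ Φ x)
    (he : HasFDerivAt Φ (e : (ℝ × ℝ) →L[ℝ] (ℝ × ℝ)) 0) (h0 : Φ 0 = 0)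
    {W : Set (ℝ × ℝ)} (hW : W ∈ 𝓝 (0 : ℝ × ℝ)) :
    ∃ (U V : Set (ℝ × ℝ)) (φ : ℝ × ℝ → ℝ × ℝ), IsOpen U ∧ IsOpen V ∧ 0 ∈ U ∧ 0 ∈ V ∧ V ⊆ W ∧
      ContDiffOn ℝ ∞ φ U ∧ ContDiffOn ℝ ∞ Φ V ∧ MapsTo φ U V ∧ MapsTo Φ V U ∧
      (∀ x ∈ U, Φ (φ x) = x) ∧ (∀ y ∈ V, φ (Φ y) = y) ∧ φ 0 = 0 := by
  have hΦ0 : ContDiffAt ℝ ∞ Φ 0 := hΦ.self_of_nhds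
  set P := hΦ0.toOpenPartialHomeomorph Φ he (by simp) with hP
  have hPc : (P : ℝ × ℝ → ℝ × ℝ) = Φ := rfl
  have hP0 : (0 : ℝ × ℝ) ∈ P.source := hΦ0.mem_toOpenPartialHomeomorph_source he (by simp)
  have hinv : ∀ᶠ x in 𝓝 (0 : ℝ × ℝ), fderiv ℝ Φ x ∈
      range ((↑) : ((ℝ × ℝ) ≃L[ℝ] (ℝ × ℝ)) → ((ℝ × ℝ) →L[ℝ] (ℝ × ℝ))) := by
    have hc : ContinuousAt (fderiv ℝ Φ) 0 :=
      (hΦ0.fderiv_right (m := 0) (by simp)).continuousAt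
    refine hc.eventually_mem ?_
    rw [he.fderiv]
    exact ContinuousLinearEquiv.nhds e
  obtain ⟨V, hVsub, hVo, hV0⟩ := mem_nhds_iff.1 (inter_mem (inter_mem hW
    (P.open_source.mem_nhds hP0)) (inter_mem hΦ hinv))
  have hVs : V ⊆ P.source := fun x hx => (hVsub hx).1.2
  have hVΦ : ∀ x ∈ V, ContDiffAt ℝ ∞ Φ x := fun x hx => (hVsub hx).2.1
  have hsymm0 : P.symm 0 = 0 := by
    have := P.left_inv hP0
    rwa [hPc, h0] at this
  refine ⟨P.target ∩ P.symm ⁻¹' V, V, P.symm, P.isOpen_inter_preimage_symm hVo, hVo, ?_, hV0,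
    fun x hx => (hVsub hx).1.1, ?_, fun x hx => (hVΦ x hx).contDiffWithinAt, fun x hx => hx.2,
    ?_, fun x hx => P.right_inv hx.1, fun y hy => P.left_inv (hVs hy), hsymm0⟩
  · refine ⟨?_, by simpa [hsymm0] using hV0⟩
    have := P.map_source hP0
    rwa [hPc, h0] at this
  · intro x hx
    obtain ⟨-, -, e', he'⟩ := hVsub hx.2
    have hs := hVΦ _ hx.2
    refine (P.contDiffAt_symm (f₀' := e') hx.1 ?_ hs).contDiffWithinAt
    rw [he']
    exact (hs.differentiableAt (by simp)).hasFDerivAt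
  · intro y hy
    refine ⟨P.map_source (hVs hy), ?_⟩
    have := P.left_inv (hVs hy)
    rw [hPc] at this
    simpa [this] using hy

theorem exists_smooth_root {f : ℝ × ℝ → ℝ} (hf : ∀ᶠ x in 𝓝 (0 : ℝ × ℝ), ContDiffAt ℝ ∞ f x)
    (h0 : f 0 ≠ 0) {m : ℕ} (hm : m ≠ 0) :
    ∃ (ε : ℝ) (r : ℝ × ℝ → ℝ), (ε = 1 ∨ ε = -1) ∧ (∀ᶠ x in 𝓝 (0 : ℝ × ℝ), ContDiffAt ℝ ∞ r x) ∧
      r 0 ≠ 0 ∧ ∀ᶠ x in 𝓝 (0 : ℝ × ℝ), f x = ε * r x ^ m := by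
  obtain ⟨ε, hε, hpos⟩ : ∃ ε : ℝ, (ε = 1 ∨ ε = -1) ∧ 0 < ε * f 0 := by
    rcases h0.lt_or_gt with h | h
    · exact ⟨-1, Or.inr rfl, by linarith⟩
    · exact ⟨1, Or.inl rfl, by linarith⟩
  have hε2 : ε * ε = 1 := by rcases hε with rfl | rfl <;> norm_num
  have hev : ∀ᶠ x in 𝓝 (0 : ℝ × ℝ), 0 < ε * f x :=
    (continuousAt_const.mul hf.self_of_nhds.continuousAt).eventually (lt_mem_nhds hpos)
  refine ⟨ε, fun x => (ε * f x) ^ ((m : ℝ)⁻¹), hε, ?_, (Real.rpow_pos_of_pos hpos _).ne', ?_⟩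
  · filter_upwards [hf, hev] with x hx hx'
    exact (contDiffAt_const.mul hx).rpow_const_of_ne hx'.ne'
  · filter_upwards [hev] with x hx
    rw [Real.rpow_inv_natCast_pow hx.le hm, ← mul_assoc, hε2, one_mul]

/-- A sum `γ (w + u² δ)² + u^(k+1) κ` with unit coefficients `γ`, `κ` has an `A_k` singularity. -/
theorem hasAkSingAt_of_sum_of_powers {h : ℝ → ℝ → ℝ} {γ δ κ : ℝ × ℝ → ℝ} {k : ℕ}
    (hγ : ∀ᶠ x in 𝓝 (0 : ℝ × ℝ), ContDiffAt ℝ ∞ γ x)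
    (hδ : ∀ᶠ x in 𝓝 (0 : ℝ × ℝ), ContDiffAt ℝ ∞ δ x)
    (hκ : ∀ᶠ x in 𝓝 (0 : ℝ × ℝ), ContDiffAt ℝ ∞ κ x) (hγ0 : γ 0 ≠ 0) (hκ0 : κ 0 ≠ 0)
    (hh : ∀ᶠ x in 𝓝 (0 : ℝ × ℝ), h x.1 x.2 =
      h 0 0 + γ x * (x.2 + x.1 ^ 2 * δ x) ^ 2 + x.1 ^ (k + 1) * κ x) :
    HasAkSingAt h k := by
  obtain ⟨ε₁, r, hε₁, hr, hr0, hγr⟩ := exists_smooth_root hγ hγ0 two_ne_zero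
  obtain ⟨ε₂, s, hε₂, hs, hs0, hκs⟩ := exists_smooth_root hκ hκ0 (Nat.add_one_ne_zero k)
  set Φ : ℝ × ℝ → ℝ × ℝ := fun x => (r x * (x.2 + x.1 ^ 2 * δ x), x.1 * s x) with hΦdef
  have hΦ : ∀ᶠ x in 𝓝 (0 : ℝ × ℝ), ContDiffAt ℝ ∞ Φ x := by
    filter_upwards [hr, hs, hδ] with x h1 h2 h3
    exact (h1.mul (contDiffAt_snd.add ((contDiffAt_fst.pow 2).mul h3))).prodMk
      (contDiffAt_fst.mul h2)
  let e : (ℝ × ℝ) ≃L[ℝ] (ℝ × ℝ) := (ContinuousLinearEquiv.prodComm ℝ ℝ ℝ).trans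
    ((ContinuousLinearEquiv.unitsEquivAut ℝ (Units.mk0 _ hr0)).prodCongr
      (ContinuousLinearEquiv.unitsEquivAut ℝ (Units.mk0 _ hs0)))
  have he : HasFDerivAt Φ (e : (ℝ × ℝ) →L[ℝ] (ℝ × ℝ)) 0 := by
    have dr := (hr.self_of_nhds.differentiableAt (by simp)).hasFDerivAt
    have ds := (hs.self_of_nhds.differentiableAt (by simp)).hasFDerivAt
    have dδ := (hδ.self_of_nhds.differentiableAt (by simp)).hasFDerivAt
    have d1 : HasFDerivAt (fun x : ℝ × ℝ => x.1) (ContinuousLinearMap.fst ℝ ℝ ℝ) 0 := hasFDerivAt_fst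
    have d2 : HasFDerivAt (fun x : ℝ × ℝ => x.2) (ContinuousLinearMap.snd ℝ ℝ ℝ) 0 := hasFDerivAt_snd
    refine ((dr.mul (d2.add ((d1.pow 2).mul dδ))).prodMk (d1.mul ds)).congr_fderiv ?_
    ext <;> simp [e]
  have h0 : Φ 0 = 0 := by simp [hΦdef]
  obtain ⟨U, V, φ, hU, hV, hU0, hV0, hVW, hφ, hΦV, hφm, hΦm, hr1, hl1, hφ0⟩ :=
    exists_smooth_local_inverse hΦ he h0 (hh.and (hγr.and hκs))
  refine ⟨U, V, φ, Φ, ε₁, ε₂, hU, hV, hU0, hV0, hφ, hΦV, hφm, hΦm, hr1, hl1, hφ0, hε₁, hε₂, ?_⟩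
  intro x hx
  obtain ⟨e1, e2, e3⟩ := hVW (hφm hx)
  have e4 := hr1 x hx
  rw [e1, e2, e3]
  have x1 : x.1 = r (φ x) * ((φ x).2 + (φ x).1 ^ 2 * δ (φ x)) := by
    conv_lhs => rw [← e4]
  have x2 : x.2 = (φ x).1 * s (φ x) := by
    conv_lhs => rw [← e4]
  rw [x1, x2]
  ring

/-- When the restriction to the parabola `w = -β(0) u² / (2 γ(0))` vanishes to fifth order, there
is no `A₂` or `A₃` singularity. -/
theorem not_hasAkSingAt_of_degenerate_quartic {h : ℝ → ℝ → ℝ} {α β : ℝ → ℝ} {γ : ℝ × ℝ → ℝ}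
    {k : ℕ} (hα : ContDiff ℝ ∞ α) (hβ : ContDiff ℝ ∞ β) (hγ : ContDiff ℝ ∞ γ)
    (hγ0 : γ (0, 0) ≠ 0) (hdisc : β 0 ^ 2 = 4 * α 0 * γ (0, 0))
    (hh : ∀ u w, h u w = h 0 0 + u ^ 4 * α u + u ^ 2 * β u * w + γ (u, w) * w ^ 2) (hk : k ≤ 3) :
    ¬ HasAkSingAt h k := by
  rintro ⟨U, V, φ, ψ, ε₁, ε₂, hU, hV, hU0, hV0, hφ, hψ, hφm, hψm, hl, hr, hφ0, hε₁, hε₂, heq⟩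
  have hε₁0 : ε₁ ≠ 0 := by rcases hε₁ with rfl | rfl <;> norm_num
  have hε₂0 : ε₂ ≠ 0 := by rcases hε₂ with rfl | rfl <;> norm_num
  have hψ0 : ψ (0, 0) = (0, 0) := by
    have := hl _ hU0
    rwa [hφ0] at this
  set s : ℝ := -β 0 / (2 * γ (0, 0)) with hs
  have hs1 : β 0 + 2 * γ (0, 0) * s = 0 := by rw [hs]; field_simp; ring
  have hs2 : α 0 + β 0 * s + γ (0, 0) * s ^ 2 = 0 := by
    rw [hs]; field_simp; linear_combination (-1 : ℝ) * hdisc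
  set c : ℝ → ℝ × ℝ := fun t => (t, s * t ^ 2) with hc
  have hcont : Continuous c := by rw [hc]; fun_prop
  have hc0 : c 0 = (0, 0) := by simp [hc]
  have hcV : ∀ᶠ t in 𝓝 (0 : ℝ), c t ∈ V :=
    hcont.continuousAt.eventually_mem (by rw [hc0]; exact hV.mem_nhds hV0)
  have hcd : HasDerivAt c (1, 0) 0 := by
    refine ((hasDerivAt_id (0 : ℝ)).prodMk (((hasDerivAt_id (0 : ℝ)).pow 2).const_mul s)).congr_deriv ?_
    simp
  have hφd : ∀ x ∈ U, HasFDerivAt φ (fderiv ℝ φ x) x := fun x hx =>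
    ((hφ.contDiffAt (hU.mem_nhds hx)).differentiableAt (by simp)).hasFDerivAt
  have hψd : HasFDerivAt ψ (fderiv ℝ ψ (0, 0)) (c 0) := by
    rw [hc0]
    exact ((hψ.contDiffAt (hV.mem_nhds hV0)).differentiableAt (by simp)).hasFDerivAt
  set d : ℝ → ℝ × ℝ := fun t => ψ (c t) with hd
  have hd0 : d 0 = (0, 0) := by simp [hd, hc0, hψ0]
  obtain ⟨d', hd'⟩ : ∃ d', HasDerivAt d d' 0 := ⟨_, hψd.comp_hasDerivAt 0 hcd⟩
  have hdc : ContinuousAt d 0 := hd'.continuousAt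
  have hfc : ContinuousAt (fun t => fderiv ℝ φ (d t) (1, 0)) 0 := by
    have h1 : ContinuousAt (fderiv ℝ φ) (d 0) := by
      rw [hd0]
      exact ((hφ.contDiffAt (hU.mem_nhds hU0)).fderiv_right (m := 0) (by simp)).continuousAt
    exact (h1.comp hdc).clm_apply continuousAt_const
  set v : ℝ → ℝ × ℝ := fun t => fderiv ℝ φ (d t) (1, 0)
  obtain ⟨v₁, hv₁, hv₁c⟩ : ∃ v₁ : ℝ → ℝ, (∀ t, v₁ t = (v t).1) ∧ ContinuousAt v₁ 0 :=
    ⟨_, fun _ => rfl, hfc.fst⟩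
  obtain ⟨v₂, hv₂, hv₂c⟩ : ∃ v₂ : ℝ → ℝ, (∀ t, v₂ t = (v t).2) ∧ ContinuousAt v₂ 0 :=
    ⟨_, fun _ => rfl, hfc.snd⟩
  obtain ⟨α', hα', hα'c⟩ : ∃ α' : ℝ → ℝ, (∀ t, HasDerivAt α (α' t) t) ∧ Continuous α' :=
    ⟨_, fun t => (hα.differentiable (by simp) t).hasDerivAt, hα.continuous_deriv (by simp)⟩
  obtain ⟨β', hβ', hβ'c⟩ : ∃ β' : ℝ → ℝ, (∀ t, HasDerivAt β (β' t) t) ∧ Continuous β' :=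
    ⟨_, fun t => (hβ.differentiable (by simp) t).hasDerivAt, hβ.continuous_deriv (by simp)⟩
  obtain ⟨γ₀, hγ₀, hγ₀c⟩ : ∃ γ₀ : ℝ → ℝ, (∀ t, γ₀ t = γ (c t)) ∧ ContinuousAt γ₀ 0 :=
    ⟨_, fun _ => rfl, (hγ.continuous.comp hcont).continuousAt⟩
  obtain ⟨γ₁, hγ₁, hγ₁c⟩ : ∃ γ₁ : ℝ → ℝ, (∀ t, γ₁ t = fderiv ℝ γ (c t) (v t)) ∧
      ContinuousAt γ₁ 0 :=
    ⟨_, fun _ => rfl,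
      ((hγ.continuous_fderiv (by simp)).comp hcont).continuousAt.clm_apply hfc⟩
  have hγ₀0 : γ₀ 0 = γ (0, 0) := by rw [hγ₀, hc0]
  have hαc := hα.continuous
  have hβc := hβ.continuous
  set G : ℝ → ℝ := fun t => 4 * t * v₁ t * α t + t ^ 2 * α' t * v₁ t
    + 2 * t * v₁ t * β t * s + t ^ 2 * β' t * v₁ t * s + β t * v₂ t
    + γ₁ t * s ^ 2 * t ^ 2 + 2 * γ₀ t * s * v₂ t with hG
  have hGt : Tendsto G (𝓝 0) (𝓝 0) := by
    have h1 : ContinuousAt G 0 := by rw [hG]; fun_prop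
    have h2 : G 0 = 0 := by
      simp only [hG, hγ₀0]
      linear_combination v₂ 0 * hs1
    simpa [ContinuousAt, h2] using h1
  have hd1 : ∀ᶠ t in 𝓝 (0 : ℝ), 2 * ε₁ * (d t).1 = t ^ 2 * G t := by
    filter_upwards [hcV] with t ht
    have htU : d t ∈ U := hψm ht
    have hφdt : φ (d t) = c t := hr _ ht
    have hlin : HasDerivAt (fun τ : ℝ => (((d t).1 + τ, (d t).2) : ℝ × ℝ)) (1, 0) 0 :=
      ((hasDerivAt_id (0 : ℝ)).const_add (d t).1).prodMk (hasDerivAt_const _ _)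
    have hlin0 : (((d t).1 + 0, (d t).2) : ℝ × ℝ) = d t := by simp
    have hcomp : HasDerivAt (fun τ : ℝ => φ ((d t).1 + τ, (d t).2)) (v t) 0 := by
      refine HasFDerivAt.comp_hasDerivAt (f := fun τ : ℝ => (((d t).1 + τ, (d t).2) : ℝ × ℝ)) 0
        ?_ hlin
      rw [hlin0]
      exact hφd _ htU
    have hφ1 : HasDerivAt (fun τ : ℝ => (φ ((d t).1 + τ, (d t).2)).1) (v t).1 0 :=
      hcomp.fst
    have hφ2 : HasDerivAt (fun τ : ℝ => (φ ((d t).1 + τ, (d t).2)).2) (v t).2 0 :=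
      hcomp.snd
    have hαφ : HasDerivAt (fun τ : ℝ => α (φ ((d t).1 + τ, (d t).2)).1) (α' t * (v t).1) 0 := by
      refine HasDerivAt.comp (h₂ := α) 0 ?_ hφ1
      rw [hlin0, hφdt]
      exact hα' t
    have hβφ : HasDerivAt (fun τ : ℝ => β (φ ((d t).1 + τ, (d t).2)).1) (β' t * (v t).1) 0 := by
      refine HasDerivAt.comp (h₂ := β) 0 ?_ hφ1
      rw [hlin0, hφdt]
      exact hβ' t
    have hγφ : HasDerivAt (fun τ : ℝ => γ (φ ((d t).1 + τ, (d t).2)))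
        (fderiv ℝ γ (c t) (v t)) 0 := by
      refine HasFDerivAt.comp_hasDerivAt (l := γ) 0 ?_ hcomp
      rw [hlin0, hφdt]
      exact (hγ.differentiable (by simp) (c t)).hasFDerivAt
    have hD1 := ((((hφ1.pow 4).mul hαφ).const_add (h 0 0)).add
      (((hφ1.pow 2).mul hβφ).mul hφ2)).add (hγφ.mul (hφ2.pow 2))
    have hD2 : HasDerivAt (fun τ : ℝ => h 0 0 + ε₁ * ((d t).1 + τ) ^ 2 + ε₂ * (d t).2 ^ (k + 1))
        (2 * ε₁ * (d t).1) 0 := by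
      have := (((((hasDerivAt_id (0 : ℝ)).const_add (d t).1).pow 2).const_mul ε₁).const_add
        (h 0 0)).add_const (ε₂ * (d t).2 ^ (k + 1))
      refine this.congr_deriv ?_
      simp
      ring
    have hev : (fun τ : ℝ => h 0 0 + ε₁ * ((d t).1 + τ) ^ 2 + ε₂ * (d t).2 ^ (k + 1)) =ᶠ[𝓝 0]
        fun τ : ℝ => h (φ ((d t).1 + τ, (d t).2)).1 (φ ((d t).1 + τ, (d t).2)).2 := by
      have : ∀ᶠ τ in 𝓝 (0 : ℝ), (((d t).1 + τ, (d t).2) : ℝ × ℝ) ∈ U :=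
        hlin.continuousAt.eventually_mem (by rw [hlin0]; exact hU.mem_nhds htU)
      filter_upwards [this] with τ hτ
      rw [heq _ hτ]
    have hfun : (fun τ : ℝ => h (φ ((d t).1 + τ, (d t).2)).1 (φ ((d t).1 + τ, (d t).2)).2) =
        fun τ : ℝ => h 0 0 + (φ ((d t).1 + τ, (d t).2)).1 ^ 4 * α (φ ((d t).1 + τ, (d t).2)).1
          + (φ ((d t).1 + τ, (d t).2)).1 ^ 2 * β (φ ((d t).1 + τ, (d t).2)).1 *
            (φ ((d t).1 + τ, (d t).2)).2
          + γ (φ ((d t).1 + τ, (d t).2)) * (φ ((d t).1 + τ, (d t).2)).2 ^ 2 := by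
      funext τ
      rw [hh]
    rw [hfun] at hev
    refine (hD2.unique (hD1.congr_of_eventuallyEq hev)).trans ?_
    simp only [Pi.pow_apply, Pi.mul_apply, hlin0, hφdt]
    simp only [hG, hv₁, hv₂, hγ₀, hγ₁]
    simp only [hc]
    push_cast
    ring
  set R : ℝ → ℝ := fun t => α t + β t * s + γ₀ t * s ^ 2 - ε₁ * (G t / (2 * ε₁)) ^ 2 with hR
  have hRt : Tendsto R (𝓝 0) (𝓝 0) := by
    have h1 : Tendsto (fun t => α t + β t * s + γ₀ t * s ^ 2) (𝓝 0) (𝓝 0) := by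
      have h2 : ContinuousAt (fun t => α t + β t * s + γ₀ t * s ^ 2) 0 := by fun_prop
      simpa [ContinuousAt, hγ₀0, hs2] using h2
    simpa using h1.sub (((hGt.div_const (2 * ε₁)).pow 2).const_mul ε₁)
  have hd2 : ∀ᶠ t in 𝓝 (0 : ℝ), ε₂ * (d t).2 ^ (k + 1) = t ^ 4 * R t := by
    filter_upwards [hcV, hd1] with t ht h1
    have h2 := heq _ (hψm ht)
    have h3 : φ (ψ (c t)) = c t := hr _ ht
    rw [h3, hh] at h2
    have h4 : (d t).1 = t ^ 2 * (G t / (2 * ε₁)) := by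
      field_simp
      linear_combination h1
    change _ = h 0 0 + ε₁ * (d t).1 ^ 2 + ε₂ * (d t).2 ^ (k + 1) at h2
    rw [h4] at h2
    simp only [hR, hγ₀]
    simp only [hc] at h2 ⊢
    linear_combination -h2
  have hslope : Tendsto (fun t => t⁻¹ • d t) (𝓝[≠] 0) (𝓝 d') := by
    have := hasDerivAt_iff_tendsto_slope_zero.1 hd'
    simpa [hd0, Prod.mk_zero_zero] using this
  have hid : Tendsto (fun t : ℝ => t) (𝓝[≠] 0) (𝓝 0) := tendsto_id.mono_left nhdsWithin_le_nhds
  have hd'1 : d'.1 = 0 := by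
    have h1 : Tendsto (fun t => (t⁻¹ • d t).1) (𝓝[≠] 0) (𝓝 d'.1) :=
      (continuous_fst.tendsto _).comp hslope
    have h2 : Tendsto (fun t => t * (G t / (2 * ε₁))) (𝓝[≠] 0) (𝓝 0) := by
      simpa using hid.mul ((hGt.mono_left nhdsWithin_le_nhds).div_const (2 * ε₁))
    refine tendsto_nhds_unique (h1.congr' ?_) h2
    filter_upwards [self_mem_nhdsWithin, nhdsWithin_le_nhds hd1] with t ht h3
    have ht' : t ≠ 0 := ht
    simp only [Prod.smul_fst, smul_eq_mul]
    field_simp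
    linear_combination h3
  have hd'2 : d'.2 = 0 := by
    have h1 : Tendsto (fun t => (t⁻¹ • d t).2 ^ (k + 1)) (𝓝[≠] 0) (𝓝 (d'.2 ^ (k + 1))) :=
      ((continuous_snd.tendsto _).comp hslope).pow _
    have h2 : Tendsto (fun t => t ^ (3 - k) * (R t / ε₂)) (𝓝[≠] 0) (𝓝 0) := by
      simpa using (hid.pow (3 - k)).mul ((hRt.mono_left nhdsWithin_le_nhds).div_const ε₂)
    have h3 : d'.2 ^ (k + 1) = 0 := by
      refine tendsto_nhds_unique (h1.congr' ?_) h2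
      filter_upwards [self_mem_nhdsWithin, nhdsWithin_le_nhds hd2] with t ht h3
      have ht' : t ≠ 0 := ht
      have h4 : t ^ 4 = t ^ (3 - k) * t ^ (k + 1) := by rw [← pow_add]; congr 1; omega
      rw [h4] at h3
      simp only [Prod.smul_snd, smul_eq_mul, mul_pow, inv_pow]
      field_simp
      linear_combination h3
    exact pow_eq_zero_iff (k.succ_ne_zero) |>.1 h3
  have hcd2 : HasDerivAt c (fderiv ℝ φ (0, 0) d') 0 := by
    have h1 : HasDerivAt (fun t => φ (d t)) (fderiv ℝ φ (0, 0) d') 0 := by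
      refine HasFDerivAt.comp_hasDerivAt (l := φ) 0 ?_ hd'
      rw [hd0]
      exact hφd _ hU0
    refine h1.congr_of_eventuallyEq ?_
    filter_upwards [hcV] with t ht using (hr _ ht).symm
  have hz : d' = 0 := Prod.ext hd'1 hd'2
  have := hcd.unique hcd2
  rw [hz, map_zero] at this
  simpa using congrArg Prod.fst this

/-- For a critical point with Hessian `diag(0, c)`, `c ≠ 0`, failing to be `A₂` or `A₃` is
detected by the cubic term along the kernel and the quartic discriminant. -/
theorem not_hasAkSingAt_two_three_iff {h : ℝ → ℝ → ℝ}
    (hh : ContDiff ℝ ∞ (fun x : ℝ × ℝ => h x.1 x.2))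
    (h10 : pd 1 0 h 0 0 = 0) (h01 : pd 0 1 h 0 0 = 0) (h20 : pd 2 0 h 0 0 = 0)
    (h11 : pd 1 1 h 0 0 = 0) (h02 : pd 0 2 h 0 0 ≠ 0) :
    (¬ HasAkSingAt h 2 ∧ ¬ HasAkSingAt h 3) ↔
      pd 3 0 h 0 0 = 0 ∧ pd 4 0 h 0 0 * pd 0 2 h 0 0 - 3 * pd 2 1 h 0 0 ^ 2 = 0 := by
  obtain ⟨α, α', β, γ, hα, hα', hβ, hγ, e, eα, p30, p40, p21, p02⟩ :=
    exists_cubic_decomposition hh h10 h01 h20 h11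
  have hγ0 : γ (0, 0) ≠ 0 := fun hz => h02 (by rw [p02, hz, mul_zero])
  have hγev : ∀ᶠ x in 𝓝 (0 : ℝ × ℝ), γ x ≠ 0 := hγ.continuous.continuousAt.eventually_ne hγ0
  have hγs : ∀ᶠ x in 𝓝 (0 : ℝ × ℝ), ContDiffAt ℝ ∞ γ x := .of_forall fun x => hγ.contDiffAt
  have hβs : ContDiff ℝ ∞ (fun x : ℝ × ℝ => β x.1) := hβ.comp contDiff_fst
  have hαs : ContDiff ℝ ∞ (fun x : ℝ × ℝ => α x.1) := hα.comp contDiff_fst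
  have hα's : ContDiff ℝ ∞ (fun x : ℝ × ℝ => α' x.1) := hα'.comp contDiff_fst
  have hδ : ∀ᶠ x in 𝓝 (0 : ℝ × ℝ), ContDiffAt ℝ ∞ (fun x : ℝ × ℝ => β x.1 / (2 * γ x)) x := by
    filter_upwards [hγev] with x hx
    exact hβs.contDiffAt.div (contDiffAt_const.mul hγ.contDiffAt) (mul_ne_zero two_ne_zero hx)
  have hq : ∀ᶠ x in 𝓝 (0 : ℝ × ℝ),
      ContDiffAt ℝ ∞ (fun x : ℝ × ℝ => β x.1 ^ 2 / (4 * γ x)) x := by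
    filter_upwards [hγev] with x hx
    exact (hβs.contDiffAt.pow 2).div (contDiffAt_const.mul hγ.contDiffAt)
      (mul_ne_zero four_ne_zero hx)
  rw [p30, p40, p21, p02]
  constructor
  · rintro ⟨n2, n3⟩
    have z : α 0 = 0 := by
      by_contra hne
      refine n2 (hasAkSingAt_of_sum_of_powers
        (κ := fun x => α x.1 - x.1 * (β x.1 ^ 2 / (4 * γ x))) hγs hδ ?_ hγ0 (by simpa using hne) ?_)
      · filter_upwards [hq] with x hx
        exact hαs.contDiffAt.sub (contDiffAt_fst.mul hx)
      · filter_upwards [hγev] with x hx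
        rw [e x.1 x.2]
        field_simp
        ring
    refine ⟨by rw [z, mul_zero], ?_⟩
    by_contra hne
    refine n3 (hasAkSingAt_of_sum_of_powers
      (κ := fun x => α' x.1 - β x.1 ^ 2 / (4 * γ x)) hγs hδ ?_ hγ0 ?_ ?_)
    · filter_upwards [hq] with x hx
      exact hα's.contDiffAt.sub hx
    · intro hz
      apply hne
      change α' 0 - β 0 ^ 2 / (4 * γ (0, 0)) = 0 at hz
      field_simp at hz
      linear_combination 12 * hz
    · filter_upwards [hγev] with x hx
      rw [e x.1 x.2, eα x.1, z]
      field_simp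
      ring
  · rintro ⟨z, hD⟩
    have z' : α 0 = 0 := by linarith
    have key : ∀ k ≤ 3, ¬ HasAkSingAt h k := fun k hk =>
      not_hasAkSingAt_of_degenerate_quartic hα' hβ hγ hγ0 (by linear_combination (-1 / 12) * hD)
        (fun u w => by rw [e u w, eα u, z']; ring) hk
    exact ⟨key 2 (by norm_num), key 3 le_rfl⟩

theorem hasAkSingAt_swap {h : ℝ → ℝ → ℝ} {k : ℕ} (H : HasAkSingAt h k) :
    HasAkSingAt (fun u w => h w u) k := by
  obtain ⟨U, V, φ, ψ, ε₁, ε₂, hU, hV, hU0, hV0, hφ, hψ, hφm, hψm, hl, hr, hφ0, hε₁, hε₂, heq⟩ := H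
  refine ⟨U, Prod.swap ⁻¹' V, fun x => (φ x).swap, fun y => ψ y.swap, ε₁, ε₂, hU,
    hV.preimage continuous_swap, hU0, hV0, ?_, ?_, fun x hx => by simpa using hφm hx,
    fun y hy => hψm hy, fun x hx => by simpa using hl x hx, fun y hy => ?_, ?_, hε₁, hε₂, heq⟩
  · exact hφ.snd.prodMk hφ.fst
  · exact hψ.comp (contDiff_snd.prodMk contDiff_fst).contDiffOn fun y hy => hy
  · change (φ (ψ y.swap)).swap = y
    rw [hr _ hy, Prod.swap_swap]
  · simp [hφ0]

theorem hasAkSingAt_swap_iff {h : ℝ → ℝ → ℝ} {k : ℕ} :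
    HasAkSingAt (fun u w => h w u) k ↔ HasAkSingAt h k :=
  ⟨hasAkSingAt_swap, hasAkSingAt_swap⟩

/-- `h_{ν₀}` has a degenerate critical point at the origin with nonzero but
non-invertible Hessian, and neither an `A₂` nor an `A₃` singularity, iff (4a) or (4b) holds. -/
theorem height_A4_or_worse_iff (p q : ℝ → ℝ → ℝ) (b : ℕ → ℝ) (a : ℕ → ℕ → ℝ)
    (hNF : NormalFormN 4 p q b a) (y₀ z₀ : ℝ)
    (hunit : (0 : ℝ) ^ 2 + y₀ ^ 2 + z₀ ^ 2 = 1) :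
    ((pd 1 0 (hgt p q (0, y₀, z₀)) 0 0 = 0 ∧ pd 0 1 (hgt p q (0, y₀, z₀)) 0 0 = 0) ∧
      ¬(pd 2 0 (hgt p q (0, y₀, z₀)) 0 0 = 0 ∧ pd 1 1 (hgt p q (0, y₀, z₀)) 0 0 = 0 ∧
          pd 0 2 (hgt p q (0, y₀, z₀)) 0 0 = 0) ∧
      pd 2 0 (hgt p q (0, y₀, z₀)) 0 0 * pd 0 2 (hgt p q (0, y₀, z₀)) 0 0 -
          pd 1 1 (hgt p q (0, y₀, z₀)) 0 0 ^ 2 = 0 ∧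
      ¬HasAkSingAt (hgt p q (0, y₀, z₀)) 2 ∧ ¬HasAkSingAt (hgt p q (0, y₀, z₀)) 3) ↔
      ((b 2 * y₀ + a 2 0 * z₀ = 0 ∧ y₀ ≠ 0 ∧ b 3 * y₀ + a 3 0 * z₀ = 0 ∧
          b 4 * y₀ ^ 2 + a 4 0 * y₀ * z₀ - 3 * a 2 1 ^ 2 * z₀ ^ 2 = 0) ∨
        (y₀ = 0 ∧ a 2 0 ≠ 0 ∧ a 0 3 = 0 ∧ a 2 0 * a 0 4 - 3 * a 1 2 ^ 2 = 0)) := by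
  obtain ⟨hp, hq, -, -, p10, p01, q10, q01, p02, hpb, hp0, hqa, a11, a02⟩ := hNF
  have hgt_eq : hgt p q (0, y₀, z₀) = fun u w => y₀ * p u w + z₀ * q u w := by
    funext u w
    simp only [hgt, dot3, gmap]
    ring
  rw [hgt_eq]
  set h : ℝ → ℝ → ℝ := fun u w => y₀ * p u w + z₀ * q u w with hh
  have hsm : ContDiff ℝ ∞ (fun x : ℝ × ℝ => h x.1 x.2) :=
    (contDiff_const.mul hp).add (contDiff_const.mul hq)
  have hpd : ∀ i j, pd i j h 0 0 = y₀ * pd i j p 0 0 + z₀ * pd i j q 0 0 := fun i j => by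
    rw [hh, pd_linear_combination y₀ z₀ hp hq]
  have hpd_u : ∀ i, 2 ≤ i → i ≤ 4 → pd i 0 h 0 0 = b i * y₀ + a i 0 * z₀ := fun i h2 h4 => by
    rw [hpd, hpb i h2 h4, hqa i 0 (by omega) (by omega)]
    ring
  have hpd_w : ∀ i j, 2 ≤ i + j → i + j ≤ 4 → 1 ≤ j → ¬(i = 0 ∧ j = 2) →
      pd i j h 0 0 = a i j * z₀ := fun i j h2 h4 hj hij => by
    rw [hpd, hp0 i j h2 h4 hj hij, hqa i j h2 h4]
    ring
  have h10 : pd 1 0 h 0 0 = 0 := by rw [hpd, p10, q10]; ring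
  have h01 : pd 0 1 h 0 0 = 0 := by rw [hpd, p01, q01]; ring
  have h20 := hpd_u 2 (by norm_num) (by norm_num)
  have h11 : pd 1 1 h 0 0 = 0 := by
    rw [hpd_w 1 1 (by norm_num) (by norm_num) le_rfl (by norm_num), a11, zero_mul]
  have h02 : pd 0 2 h 0 0 = y₀ := by
    rw [hpd, p02, hqa 0 2 (by norm_num) (by norm_num), a02]
    ring
  by_cases hy : y₀ = 0
  · have hz2 : z₀ ^ 2 = 1 := by rw [hy] at hunit; linarith
    have hz : z₀ ≠ 0 := by rintro rfl; norm_num at hz2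
    have h20' : pd 2 0 h 0 0 = a 2 0 * z₀ := by rw [h20, hy]; ring
    rw [hy] at h02
    have hswap := pd_swap hsm
    have main : a 2 0 ≠ 0 → ((¬HasAkSingAt h 2 ∧ ¬HasAkSingAt h 3) ↔
        a 0 3 = 0 ∧ a 2 0 * a 0 4 - 3 * a 1 2 ^ 2 = 0) := fun ha => by
      have := not_hasAkSingAt_two_three_iff (h := fun u w => h w u)
        (hsm.comp (f := Prod.swap) (contDiff_snd.prodMk contDiff_fst))
        (by rw [hswap, h01]) (by rw [hswap, h10]) (by rw [hswap, h02]) (by rw [hswap, h11])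
        (by rw [hswap, h20']; exact mul_ne_zero ha hz)
      rw [hasAkSingAt_swap_iff (h := h) (k := 2), hasAkSingAt_swap_iff (h := h) (k := 3)] at this
      simp only [hswap] at this
      rw [this, h20', hpd_w 0 3 (by norm_num) (by norm_num) (by norm_num) (by norm_num),
        hpd_w 0 4 (by norm_num) (by norm_num) (by norm_num) (by norm_num),
        hpd_w 1 2 (by norm_num) (by norm_num) (by norm_num) (by norm_num)]
      have e : a 0 4 * z₀ * (a 2 0 * z₀) - 3 * (a 1 2 * z₀) ^ 2 =
          a 2 0 * a 0 4 - 3 * a 1 2 ^ 2 := by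
        linear_combination (a 2 0 * a 0 4 - 3 * a 1 2 ^ 2) * hz2
      rw [e, mul_eq_zero, or_iff_left hz]
    rw [h10, h01, h11, h02, h20']
    constructor
    · rintro ⟨-, hne, -, hA⟩
      have ha : a 2 0 ≠ 0 := fun h0 => hne ⟨by rw [h0, zero_mul], rfl, rfl⟩
      exact Or.inr ⟨hy, ha, (main ha).1 hA⟩
    · rintro (⟨-, hy', -⟩ | ⟨-, ha, hA⟩)
      · exact absurd hy hy'
      · exact ⟨⟨rfl, rfl⟩, fun h0 => mul_ne_zero ha hz h0.1, by ring, (main ha).2 hA⟩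
  · have main : b 2 * y₀ + a 2 0 * z₀ = 0 → ((¬HasAkSingAt h 2 ∧ ¬HasAkSingAt h 3) ↔
        b 3 * y₀ + a 3 0 * z₀ = 0 ∧
          b 4 * y₀ ^ 2 + a 4 0 * y₀ * z₀ - 3 * a 2 1 ^ 2 * z₀ ^ 2 = 0) := fun h0 => by
      rw [not_hasAkSingAt_two_three_iff hsm h10 h01 (h20.trans h0) h11 (by rwa [h02]), h02,
        hpd_u 3 (by norm_num) (by norm_num), hpd_u 4 (by norm_num) (by norm_num),
        hpd_w 2 1 (by norm_num) (by norm_num) (by norm_num) (by norm_num)]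
      have e : (b 4 * y₀ + a 4 0 * z₀) * y₀ - 3 * (a 2 1 * z₀) ^ 2 =
          b 4 * y₀ ^ 2 + a 4 0 * y₀ * z₀ - 3 * a 2 1 ^ 2 * z₀ ^ 2 := by ring
      rw [e]
    rw [h10, h01, h11, h02, h20]
    constructor
    · rintro ⟨-, -, hdet, hA⟩
      have h0 : b 2 * y₀ + a 2 0 * z₀ = 0 := by
        have : (b 2 * y₀ + a 2 0 * z₀) * y₀ = 0 := by linarith
        exact (mul_eq_zero.1 this).resolve_right hy
      exact Or.inl ⟨h0, hy, (main h0).1 hA⟩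
    · rintro (⟨h0, -, hA⟩ | ⟨hy', -⟩)
      · exact ⟨⟨rfl, rfl⟩, fun hz => hy hz.2.2, by rw [h0]; ring, (main h0).2 hA⟩
      · exact absurd hy' hy
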